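/- arXiv:1805.04155 — 5 statements merged into one kernel-verified Lean document; each statement's English description precedes it below -/
import Mathlib

section
/- The time-discretized constitutive problem has at most one solution: if (ε^p₁, χ₁) and (ε^p₂, χ₂) are both solutions, then ε^p₁ = ε^p₂ and χ₁ = χ₂ (hence the corresponding generalized stresses σ = A(ε − ε^p) and β = H(χ) also coincide). -/
open RealInnerProductSpace

/-- A pair `(εp, χ)` is a solution of the time-discretized constitutive problem with
elasticity map `A`, hardening map `H`, admissible set `B` and data `ε, εp_prev, χ_prev`:
setting `σ = A(ε − εp)` and `β = H(χ)`, one has `(σ, β) ∈ B` and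
`⟪εp − εp_prev, τσ − σ⟫ + ⟪χ_prev − χ, τβ − β⟫ ≤ 0` for all `(τσ, τβ) ∈ B`. -/
def IsSolution {V W : Type*} [NormedAddCommGroup V] [InnerProductSpace ℝ V]
    [NormedAddCommGroup W] [InnerProductSpace ℝ W]
    (A : V →ₗ[ℝ] V) (H : W → W) (B : Set (V × W))
    (ε εp_prev : V) (χ_prev : W) (εp : V) (χ : W) : Prop :=
  (A (ε - εp), H χ) ∈ B ∧
    ∀ τ ∈ B, ⟪εp - εp_prev, τ.1 - A (ε - εp)⟫ + ⟪χ_prev - χ, τ.2 - H χ⟫ ≤ 0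

/-- The time-discretized constitutive problem has at most one solution. -/
theorem discretized_constitutive_problem_unique
    {V W : Type*} [NormedAddCommGroup V] [InnerProductSpace ℝ V] [FiniteDimensional ℝ V]
    [NormedAddCommGroup W] [InnerProductSpace ℝ W] [FiniteDimensional ℝ W]
    (A : V →ₗ[ℝ] V) (hAsym : ∀ u v : V, ⟪A u, v⟫ = ⟪u, A v⟫)
    (α : ℝ) (hα : 0 < α) (hApos : ∀ v : V, α * ‖v‖ ^ 2 ≤ ⟪A v, v⟫)
    (H : W → W) (m : ℝ) (hm : 0 < m)
    (hH : ∀ x y : W, m * ‖x - y‖ ^ 2 ≤ ⟪H x - H y, x - y⟫)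
    (B : Set (V × W)) (hB : Convex ℝ B)
    (ε εp_prev : V) (χ_prev : W)
    (εp₁ εp₂ : V) (χ₁ χ₂ : W)
    (h₁ : IsSolution A H B ε εp_prev χ_prev εp₁ χ₁)
    (h₂ : IsSolution A H B ε εp_prev χ_prev εp₂ χ₂) :
    εp₁ = εp₂ ∧ χ₁ = χ₂ := by
  have hVI₁ := h₁.2 _ h₂.1
  have hVI₂ := h₂.2 _ h₁.1
  have hA := hApos (εp₁ - εp₂)
  have hχ := hH χ₁ χ₂
  simp only [map_sub, inner_sub_left, inner_sub_right] at hVI₁ hVI₂ hA hχ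
  simp only [real_inner_comm] at hVI₁ hVI₂ hA hχ
  have hsum : α * ‖εp₁ - εp₂‖ ^ 2 + m * ‖χ₁ - χ₂‖ ^ 2 ≤ 0 := by linarith
  have hεp_nonneg : 0 ≤ α * ‖εp₁ - εp₂‖ ^ 2 := by positivity
  have hχ_nonneg : 0 ≤ m * ‖χ₁ - χ₂‖ ^ 2 := by positivity
  have hεp_zero : α * ‖εp₁ - εp₂‖ ^ 2 = 0 := by linarith
  have hχ_zero : m * ‖χ₁ - χ₂‖ ^ 2 = 0 := by linarith
  constructor
  · simpa [hα.ne', sub_eq_zero] using hεp_zero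
  · simpa [hm.ne', sub_eq_zero] using hχ_zero
end

section
/- Elastic predictor: if the trial generalized stress is admissible, i.e. (A(ε − ε^p_prev), H(χ_prev)) ∈ B, then the unchanged pair (ε^p_prev, χ_prev) is a solution of the time-discretized constitutive problem, and it is the unique solution. -/
open RealInnerProductSpace

/-- Elastic predictor: if the trial generalized stress `(A(ε − εp_prev), H(χ_prev))` is
admissible, then the unchanged pair `(εp_prev, χ_prev)` is a solution of the
time-discretized constitutive problem, and it is the unique solution. -/
theorem elastic_predictor
    {V W : Type*} [NormedAddCommGroup V] [InnerProductSpace ℝ V] [FiniteDimensional ℝ V]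
    [NormedAddCommGroup W] [InnerProductSpace ℝ W] [FiniteDimensional ℝ W]
    (A : V →ₗ[ℝ] V) (hAsym : ∀ u v : V, ⟪A u, v⟫ = ⟪u, A v⟫)
    (α : ℝ) (hα : 0 < α) (hApos : ∀ v : V, α * ‖v‖ ^ 2 ≤ ⟪A v, v⟫)
    (H : W → W) (m : ℝ) (hm : 0 < m)
    (hH : ∀ x y : W, m * ‖x - y‖ ^ 2 ≤ ⟪H x - H y, x - y⟫)
    (B : Set (V × W)) (hB : Convex ℝ B)
    (ε εp_prev : V) (χ_prev : W)
    (htrial : (A (ε - εp_prev), H χ_prev) ∈ B) :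
    IsSolution A H B ε εp_prev χ_prev εp_prev χ_prev ∧
      ∀ (εp : V) (χ : W), IsSolution A H B ε εp_prev χ_prev εp χ →
        εp = εp_prev ∧ χ = χ_prev := by
  refine ⟨⟨htrial, fun τ _ => by simp⟩, fun εp χ h => ?_⟩
  have hle := h.2 _ htrial
  have hσ : A (ε - εp_prev) - A (ε - εp) = A (εp - εp_prev) := by
    rw [← map_sub, sub_sub_sub_cancel_left]
  simp only [hσ] at hle
  rw [← hAsym, real_inner_comm (H χ_prev - H χ)] at hle
  have hA := hApos (εp - εp_prev)
  have hHχ := hH χ_prev χ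
  have hA0 : 0 ≤ α * ‖εp - εp_prev‖ ^ 2 := by positivity
  have hH0 : 0 ≤ m * ‖χ_prev - χ‖ ^ 2 := by positivity
  have hε : α * ‖εp - εp_prev‖ ^ 2 = 0 := by linarith
  have hχ : m * ‖χ_prev - χ‖ ^ 2 = 0 := by linarith
  constructor
  · simpa [hα.ne', sub_eq_zero] using hε
  · simpa [hm.ne', sub_eq_zero, eq_comm] using hχ
end

section
/- Radial return for the von Mises model with kinematic hardening: in the plastic case |s^tr| > Y, the updated stress and back-stress satisfy dev(σ_k) − β_k = Y·n^tr; in particular tr(β_k) = 0 and the consistency condition Ψ(σ_k, β_k) = |dev(σ_k − β_k)| − Y = 0 holds. -/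
open Matrix

/-- Frobenius inner product on 3×3 real matrices. -/
noncomputable def frob (σ τ : Matrix (Fin 3) (Fin 3) ℝ) : ℝ := ∑ i, ∑ j, σ i j * τ i j

/-- Frobenius norm. -/
noncomputable def fnorm (τ : Matrix (Fin 3) (Fin 3) ℝ) : ℝ := Real.sqrt (frob τ τ)

/-- Deviatoric part. -/
noncomputable def devM (τ : Matrix (Fin 3) (Fin 3) ℝ) : Matrix (Fin 3) (Fin 3) ℝ :=
  τ - (Matrix.trace τ / 3) • (1 : Matrix (Fin 3) (Fin 3) ℝ)

/-- The isotropic elasticity tensor `ℂε = K tr(ε) I + 2G dev(ε)`. -/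
noncomputable def Celast (K G : ℝ) (ε : Matrix (Fin 3) (Fin 3) ℝ) : Matrix (Fin 3) (Fin 3) ℝ :=
  (K * Matrix.trace ε) • (1 : Matrix (Fin 3) (Fin 3) ℝ) + (2 * G) • devM ε

lemma fnorm_smul_of_nonneg {c : ℝ} (hc : 0 ≤ c) (τ : Matrix (Fin 3) (Fin 3) ℝ) :
    fnorm (c • τ) = c * fnorm τ := by
  have h : frob (c • τ) (c • τ) = c ^ 2 * frob τ τ := by
    simp only [frob, Matrix.smul_apply, smul_eq_mul, Finset.mul_sum]
    exact Finset.sum_congr rfl fun i _ => Finset.sum_congr rfl fun j _ => by ring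
  rw [fnorm, fnorm, h, Real.sqrt_mul (sq_nonneg c), Real.sqrt_sq hc]

lemma trace_devM (τ : Matrix (Fin 3) (Fin 3) ℝ) : Matrix.trace (devM τ) = 0 := by
  simp [devM, Matrix.trace_sub, Matrix.trace_smul]

lemma devM_of_trace_eq_zero {τ : Matrix (Fin 3) (Fin 3) ℝ} (h : Matrix.trace τ = 0) :
    devM τ = τ := by
  simp [devM, h]

lemma devM_sub (σ τ : Matrix (Fin 3) (Fin 3) ℝ) : devM (σ - τ) = devM σ - devM τ := by
  simp only [devM, Matrix.trace_sub]
  module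

/-- Radial return for the von Mises model with kinematic hardening: in the plastic case
`|s^tr| > Y`, the updated stress and back-stress satisfy `dev σₖ − βₖ = Y n^tr`;
in particular `tr βₖ = 0` and the consistency condition
`Ψ(σₖ, βₖ) = |dev(σₖ − βₖ)| − Y = 0` holds. -/
theorem vonMises_radial_return (K G a Y : ℝ) (hK : 0 < K) (hG : 0 < G) (ha : 0 < a)
    (hY : 0 < Y) (εk εp βp : Matrix (Fin 3) (Fin 3) ℝ)
    (hεk : εk.IsSymm) (hεp : εp.IsSymm) (hβp : βp.IsSymm) (hβtr : Matrix.trace βp = 0)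
    (σtr str ntr σk βk : Matrix (Fin 3) (Fin 3) ℝ) (Δlam : ℝ)
    (hσtr : σtr = Celast K G (εk - εp))
    (hstr : str = devM σtr - βp)
    (hplastic : Y < fnorm str)
    (hntr : ntr = (fnorm str)⁻¹ • str)
    (hΔlam : Δlam = (fnorm str - Y) / (2 * G + a))
    (hσk : σk = σtr - (2 * G * Δlam) • ntr)
    (hβk : βk = βp + (a * Δlam) • ntr) :
    devM σk - βk = Y • ntr ∧ Matrix.trace βk = 0 ∧ fnorm (devM (σk - βk)) - Y = 0 := by
  have hpos : 0 < fnorm str := hY.trans hplastic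
  have htr_str : Matrix.trace str = 0 := by
    rw [hstr, Matrix.trace_sub, trace_devM, hβtr, sub_zero]
  have htr_smul (c : ℝ) : Matrix.trace (c • ntr) = 0 := by
    rw [hntr, Matrix.trace_smul, Matrix.trace_smul, htr_str, smul_zero, smul_zero]
  have hβk_tr : Matrix.trace βk = 0 := by
    rw [hβk, Matrix.trace_add, hβtr, htr_smul, add_zero]
  have hstr_eq : str = fnorm str • ntr := by
    rw [hntr, smul_inv_smul₀ hpos.ne']
  have hlam : (2 * G + a) * Δlam = fnorm str - Y := by
    rw [hΔlam]
    exact mul_div_cancel₀ _ (by positivity)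
  have hmain : devM σk - βk = Y • ntr := by
    calc devM σk - βk = str - ((2 * G + a) * Δlam) • ntr := by
          rw [hσk, devM_sub, devM_of_trace_eq_zero (htr_smul _), hβk, hstr]
          module
      _ = fnorm str • ntr - (fnorm str - Y) • ntr := by rw [hlam, ← hstr_eq]
      _ = Y • ntr := by module
  refine ⟨hmain, hβk_tr, ?_⟩
  rw [devM_sub, devM_of_trace_eq_zero hβk_tr, hmain, fnorm_smul_of_nonneg hY.le, hntr,
    fnorm_smul_of_nonneg (inv_nonneg.mpr hpos.le), inv_mul_cancel₀ hpos.ne', mul_one, sub_self]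
end

section
/- The Drucker–Prager stress-strain operator T_k is globally Lipschitz continuous on Sym(3): there exists a constant L ≥ 0 such that |T_k(ε₁) − T_k(ε₂)| ≤ L·|ε₁ − ε₂| for all ε₁, ε₂ ∈ Sym(3); in particular the three branches of the definition match continuously across the case boundaries. -/
open Matrix

/-- The Drucker–Prager yield function `Ψ(τ) = √(1/2)|dev τ| + (η/3) tr τ − c`. -/
noncomputable def PsiDP (η c : ℝ) (τ : Matrix (Fin 3) (Fin 3) ℝ) : ℝ :=
  Real.sqrt (1 / 2) * fnorm (devM τ) + η / 3 * Matrix.trace τ - c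

/-- The Drucker–Prager stress-strain operator `T_k`, defined piecewise by the elastic
branch, the return to the smooth portion of the yield surface, and the return to the
apex. -/
noncomputable def TDP (K G η c : ℝ) (εp ε : Matrix (Fin 3) (Fin 3) ℝ) :
    Matrix (Fin 3) (Fin 3) ℝ :=
  let σtr := Celast K G (ε - εp)
  let str := devM σtr
  let ρtr := fnorm str
  let ptr := Matrix.trace σtr / 3
  let Δlam := PsiDP η c σtr / (G + K * η ^ 2)
  if PsiDP η c σtr ≤ 0 then σtr
  else if η * ptr - K * η ^ 2 / (G * Real.sqrt 2) * ρtr < c then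
    σtr - (Δlam * (G * Real.sqrt 2)) • (ρtr⁻¹ • str) -
      (Δlam * (K * η)) • (1 : Matrix (Fin 3) (Fin 3) ℝ)
  else (c / η) • (1 : Matrix (Fin 3) (Fin 3) ℝ)

section Radial

variable {E : Type*} [NormedAddCommGroup E] [NormedSpace ℝ E]

theorem norm_smul_inv_norm_smul_self (s : E) : ‖s‖ • (‖s‖⁻¹ • s) = s := by
  rcases eq_or_ne s 0 with rfl | hs
  · simp
  · rw [smul_smul, mul_inv_cancel₀ (norm_ne_zero_iff.2 hs), one_smul]

theorem norm_inv_norm_smul_self_le_one (s : E) : ‖‖s‖⁻¹ • s‖ ≤ 1 := by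
  rw [norm_smul, norm_inv, norm_norm]
  exact inv_mul_le_one

theorem norm_smul_direction_sub_le (s t : E) (m n : ℝ) (hn : 0 ≤ n) (hnt : n ≤ ‖t‖) :
    ‖m • (‖s‖⁻¹ • s) - n • (‖t‖⁻¹ • t)‖ ≤ |m - n| + 2 * ‖s - t‖ := by
  have hs := norm_smul_inv_norm_smul_self s
  have ht := norm_smul_inv_norm_smul_self t
  have hs1 := norm_inv_norm_smul_self_le_one s
  set u := ‖s‖⁻¹ • s
  set v := ‖t‖⁻¹ • t
  have hdir : ‖t‖ * ‖u - v‖ ≤ 2 * ‖s - t‖ := by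
    have hsplit : ‖t‖ • (u - v) = (‖t‖ - ‖s‖) • u + (s - t) := by
      rw [smul_sub, sub_smul, hs, ht]; abel
    calc ‖t‖ * ‖u - v‖ = ‖‖t‖ • (u - v)‖ := by rw [norm_smul, norm_norm]
      _ ≤ |‖t‖ - ‖s‖| * ‖u‖ + ‖s - t‖ := by
          rw [hsplit, ← Real.norm_eq_abs, ← norm_smul]; exact norm_add_le _ _
      _ ≤ ‖s - t‖ * 1 + ‖s - t‖ := by
          gcongr
          rw [norm_sub_rev s t]; exact abs_norm_sub_norm_le t s
      _ = 2 * ‖s - t‖ := by ring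
  calc ‖m • u - n • v‖ = ‖(m - n) • u + n • (u - v)‖ := by
        rw [sub_smul, smul_sub]; abel_nf
    _ ≤ |m - n| * ‖u‖ + n * ‖u - v‖ := by
        refine (norm_add_le _ _).trans_eq ?_
        rw [norm_smul (m - n), norm_smul n, Real.norm_eq_abs, Real.norm_of_nonneg hn]
    _ ≤ |m - n| * 1 + ‖t‖ * ‖u - v‖ := by gcongr
    _ ≤ |m - n| + 2 * ‖s - t‖ := by linarith

theorem LipschitzWith.smul_direction {X : Type*} [PseudoMetricSpace X] {s : X → E}
    {m : X → ℝ} {A B : NNReal} (hs : LipschitzWith A s) (hm : LipschitzWith B m)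
    (hm0 : ∀ x, 0 ≤ m x) (hms : ∀ x, m x ≤ ‖s x‖) :
    LipschitzWith (B + 2 * A) fun x => m x • (‖s x‖⁻¹ • s x) := by
  refine LipschitzWith.of_dist_le_mul fun x y => ?_
  rw [dist_eq_norm]
  refine (norm_smul_direction_sub_le (s x) (s y) (m x) (m y) (hm0 y) (hms y)).trans ?_
  have h1 := hm.dist_le_mul x y
  have h2 := hs.dist_le_mul x y
  rw [Real.dist_eq] at h1
  rw [dist_eq_norm] at h2
  push_cast
  linarith

/-- Magnitude of the returned deviatoric stress, as a function of the norm `ρ` of the trial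
deviator and of the value `ψ` of the yield function. -/
noncomputable def returnedRadius (β ρ ψ : ℝ) : ℝ := max 0 (ρ - β * max 0 ψ)

theorem exists_lipschitzWith_return [FiniteDimensional ℝ E] (S : E →ₗ[ℝ] E) (P : E →ₗ[ℝ] ℝ)
    (e : E) {a β η c : ℝ} (hβ : 0 ≤ β) :
    ∃ L : NNReal, LipschitzWith L fun x =>
      returnedRadius β ‖S x‖ (a * ‖S x‖ + η * P x - c) • (‖S x‖⁻¹ • S x) +
        min (P x) ((c - a * returnedRadius β ‖S x‖ (a * ‖S x‖ + η * P x - c)) / η) • e := by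
  have hS := S.toContinuousLinearMap.lipschitz
  have hP := P.toContinuousLinearMap.lipschitz
  have hmul : ∀ k : ℝ, LipschitzWith ‖k‖₊ fun x : ℝ => k * x := fun k => lipschitzWith_smul k
  have hρ := lipschitzWith_one_norm.comp hS
  have hψ := (((hmul a).comp hρ).add ((hmul η).comp hP)).sub (LipschitzWith.const c)
  have hm := (hρ.sub ((hmul β).comp (hψ.const_max 0))).const_max 0
  have hq := hP.min ((hmul η⁻¹).comp ((LipschitzWith.const c).sub ((hmul a).comp hm)))
  have he : LipschitzWith ‖e‖₊ fun r : ℝ => r • e :=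
    LipschitzWith.of_dist_le_mul fun x y => by
      rw [dist_eq_norm, ← sub_smul, norm_smul, dist_eq_norm, mul_comm, coe_nnnorm]
  have hdir := hS.smul_direction hm (fun x => le_max_left _ _) fun x =>
    max_le (norm_nonneg _) (sub_le_self _ (mul_nonneg hβ (le_max_left _ _)))
  have h := hdir.add (he.comp hq)
  simp only [Function.comp_apply, LinearMap.coe_toContinuousLinearMap', inv_mul_eq_div] at h
  exact ⟨_, h⟩

end Radial

/-- `devM` as a linear map. -/
noncomputable def devLin : Matrix (Fin 3) (Fin 3) ℝ →ₗ[ℝ] Matrix (Fin 3) (Fin 3) ℝ where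
  toFun := devM
  map_add' x y := by simp only [devM, trace_add]; module
  map_smul' k x := by simp only [devM, trace_smul, smul_eq_mul, RingHom.id_apply]; module

/-- `Celast` as a linear map. -/
noncomputable def celastLin (K G : ℝ) :
    Matrix (Fin 3) (Fin 3) ℝ →ₗ[ℝ] Matrix (Fin 3) (Fin 3) ℝ where
  toFun := Celast K G
  map_add' x y := by simp only [Celast, devM, trace_add]; module
  map_smul' k x := by
    simp only [Celast, devM, trace_smul, smul_eq_mul, RingHom.id_apply]; module

section Frobenius

attribute [local instance] Matrix.frobeniusNormedAddCommGroup Matrix.frobeniusNormedSpace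

theorem fnorm_eq_norm (τ : Matrix (Fin 3) (Fin 3) ℝ) : fnorm τ = ‖τ‖ := by
  rw [Matrix.frobenius_norm_def, fnorm, frob, Real.sqrt_eq_rpow]
  simp [pow_two]

theorem TDP_eq_return {K G η : ℝ} (c : ℝ) (hK : 0 < K) (hG : 0 < G) (hη : 0 < η)
    (εp ε : Matrix (Fin 3) (Fin 3) ℝ) :
    let s := devM (Celast K G (ε - εp))
    let p := Matrix.trace (Celast K G (ε - εp)) / 3
    let m := returnedRadius (G * √2 / (G + K * η ^ 2)) ‖s‖ (√(1 / 2) * ‖s‖ + η * p - c)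
    TDP K G η c εp ε = m • (‖s‖⁻¹ • s) + min p ((c - √(1 / 2) * m) / η) • 1 := by
  intro s p m
  have hψ : PsiDP η c (Celast K G (ε - εp)) = √(1 / 2) * ‖s‖ + η * p - c := by
    rw [PsiDP, fnorm_eq_norm]; ring
  have hsplit : Celast K G (ε - εp) = s + p • 1 := by simp only [s, p, devM]; abel
  have hs := norm_smul_inv_norm_smul_self s
  have hρ : 0 ≤ ‖s‖ := norm_nonneg s
  have h2 : √2 * √2 = 2 := Real.mul_self_sqrt (by norm_num)
  have h20 : 0 < √2 := by positivity
  have hhalf : √(1 / 2) = √2 / 2 := by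
    rw [Real.sqrt_div zero_le_one, Real.sqrt_one]; field_simp; linarith
  have hD : 0 < G + K * η ^ 2 := by positivity
  unfold TDP
  dsimp only
  rw [fnorm_eq_norm, hψ]
  change (if _ then Celast K G (ε - εp) else if η * p - _ * ‖s‖ < c then
    Celast K G (ε - εp) - _ • (‖s‖⁻¹ • s) - _ else _) = _
  rw [hsplit]
  have hradius : (‖s‖ - G * √2 / (G + K * η ^ 2) * (√(1 / 2) * ‖s‖ + η * p - c)) *
      (G + K * η ^ 2) = G * √2 * (c - (η * p - K * η ^ 2 / (G * √2) * ‖s‖)) := by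
    rw [hhalf]; field_simp; linear_combination (-(G * ‖s‖)) * h2
  split_ifs with hel hsm
  · have hm : m = ‖s‖ := by
      simp only [m, returnedRadius, max_eq_left hel, mul_zero, sub_zero, max_eq_right hρ]
    rw [hm, hs, min_eq_left]
    rw [le_div_iff₀ hη]; linarith
  · have hm : m = ‖s‖ - G * √2 / (G + K * η ^ 2) * (√(1 / 2) * ‖s‖ + η * p - c) := by
      simp only [m, returnedRadius]
      rw [max_eq_right (not_le.1 hel).le, max_eq_right]
      refine nonneg_of_mul_nonneg_left ?_ hD
      rw [hradius]
      exact mul_nonneg (by positivity) (sub_nonneg.2 hsm.le)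
    have hq : (c - √(1 / 2) * m) / η =
        p - (√(1 / 2) * ‖s‖ + η * p - c) / (G + K * η ^ 2) * (K * η) := by
      rw [hm, hhalf]; field_simp; linear_combination
        (G * (√2 * ‖s‖ + 2 * (η * p - c))) * h2
    rw [min_eq_right, hq, hm]
    · nth_rewrite 1 [← hs]
      module
    · rw [hq, sub_le_self_iff]
      have := (not_le.1 hel).le
      positivity
  · have hm : m = 0 := by
      simp only [m, returnedRadius]
      rw [max_eq_right (not_le.1 hel).le, max_eq_left]
      refine nonpos_of_mul_nonpos_left ?_ hD
      rw [hradius]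
      exact mul_nonpos_of_nonneg_of_nonpos (by positivity) (sub_nonpos.2 (not_lt.1 hsm))
    rw [hm, min_eq_right]
    · simp
    · rw [div_le_iff₀ hη]
      have : 0 ≤ K * η ^ 2 / (G * √2) * ‖s‖ := by positivity
      linarith [not_lt.1 hsm]

theorem exists_fnorm_TDP_sub_le {K G η : ℝ} (c : ℝ) (hK : 0 < K) (hG : 0 < G) (hη : 0 < η)
    (εp : Matrix (Fin 3) (Fin 3) ℝ) :
    ∃ L : NNReal, ∀ ε₁ ε₂ : Matrix (Fin 3) (Fin 3) ℝ,
      fnorm (TDP K G η c εp ε₁ - TDP K G η c εp ε₂) ≤ L * fnorm (ε₁ - ε₂) := by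
  have hβ : 0 ≤ G * √2 / (G + K * η ^ 2) := by positivity
  obtain ⟨L, hL⟩ := exists_lipschitzWith_return (devLin ∘ₗ celastLin K G)
    ((3 : ℝ)⁻¹ • (Matrix.traceLinearMap (Fin 3) ℝ ℝ ∘ₗ celastLin K G)) 1
    (a := √(1 / 2)) (η := η) (c := c) hβ
  refine ⟨L, fun ε₁ ε₂ => ?_⟩
  have h := hL.dist_le_mul (ε₁ - εp) (ε₂ - εp)
  rw [dist_sub_right, dist_eq_norm, dist_eq_norm] at h
  rw [fnorm_eq_norm, fnorm_eq_norm, TDP_eq_return c hK hG hη, TDP_eq_return c hK hG hη]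
  simpa [div_eq_inv_mul, devLin, celastLin] using h

end Frobenius

/-- The Drucker–Prager stress-strain operator is globally Lipschitz continuous on
`Sym(3)`; in particular the three branches of its definition match continuously across
the case boundaries. -/
theorem druckerPrager_lipschitz (K G η c : ℝ)
    (hK : 0 < K) (hG : 0 < G) (hη : 0 < η) (hc : 0 < c)
    (εp : Matrix (Fin 3) (Fin 3) ℝ) (hεp : εp.IsSymm) :
    ∃ L : ℝ, 0 ≤ L ∧ ∀ ε₁ ε₂ : Matrix (Fin 3) (Fin 3) ℝ, ε₁.IsSymm → ε₂.IsSymm →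
      fnorm (TDP K G η c εp ε₁ - TDP K G η c εp ε₂) ≤ L * fnorm (ε₁ - ε₂) := by
  obtain ⟨L, hL⟩ := exists_fnorm_TDP_sub_le c hK hG hη εp
  exact ⟨L, L.coe_nonneg, fun ε₁ ε₂ _ _ => hL ε₁ ε₂⟩
end

section
/- Global admissibility of the Drucker–Prager return mapping: for every strain ε ∈ Sym(3), the returned stress is admissible, i.e. Ψ(T_k(ε)) ≤ 0. -/
open Matrix

lemma fnorm_nonneg (τ : Matrix (Fin 3) (Fin 3) ℝ) : 0 ≤ fnorm τ := Real.sqrt_nonneg _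

lemma fnorm_zero : fnorm 0 = 0 := by simp [fnorm, frob]

lemma fnorm_smul (r : ℝ) (τ : Matrix (Fin 3) (Fin 3) ℝ) : fnorm (r • τ) = |r| * fnorm τ := by
  have h : frob (r • τ) (r • τ) = r ^ 2 * frob τ τ := by
    simp only [frob, Finset.mul_sum, Matrix.smul_apply, smul_eq_mul]
    exact Finset.sum_congr rfl fun i _ => Finset.sum_congr rfl fun j _ => by ring
  rw [fnorm, h, Real.sqrt_mul (sq_nonneg r), Real.sqrt_sq_eq_abs, fnorm]

lemma devM_smul_one (a : ℝ) : devM (a • (1 : Matrix (Fin 3) (Fin 3) ℝ)) = 0 := by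
  simp [devM]

lemma trace_sub_smul_devM_sub_smul_one (σ : Matrix (Fin 3) (Fin 3) ℝ) (a b : ℝ) :
    Matrix.trace (σ - a • devM σ - b • (1 : Matrix (Fin 3) (Fin 3) ℝ)) =
      Matrix.trace σ - 3 * b := by
  simp [trace_devM, mul_comm]

lemma devM_sub_smul_devM_sub_smul_one (σ : Matrix (Fin 3) (Fin 3) ℝ) (a b : ℝ) :
    devM (σ - a • devM σ - b • (1 : Matrix (Fin 3) (Fin 3) ℝ)) = (1 - a) • devM σ := by
  rw [devM, trace_sub_smul_devM_sub_smul_one]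
  simp only [devM]
  module

/-- The yield function vanishes at the apex `(c / η) I`. -/
lemma PsiDP_apex {η : ℝ} (hη : η ≠ 0) (c : ℝ) :
    PsiDP η c ((c / η) • (1 : Matrix (Fin 3) (Fin 3) ℝ)) = 0 := by
  rw [PsiDP, devM_smul_one, fnorm_zero]
  simp
  field_simp
  ring

/-- The smooth return places the stress on the yield surface, provided the trial stress is
plastic and below the apex threshold. -/
lemma PsiDP_smooth_return {K G η c : ℝ} (hK : 0 < K) (hG : 0 < G)
    {σ : Matrix (Fin 3) (Fin 3) ℝ} (hσ : 0 < PsiDP η c σ)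
    (hs : η * (Matrix.trace σ / 3) - K * η ^ 2 / (G * Real.sqrt 2) * fnorm (devM σ) < c) :
    PsiDP η c (σ - (PsiDP η c σ / (G + K * η ^ 2) * (G * Real.sqrt 2)) •
        ((fnorm (devM σ))⁻¹ • devM σ) -
      (PsiDP η c σ / (G + K * η ^ 2) * (K * η)) • (1 : Matrix (Fin 3) (Fin 3) ℝ)) = 0 := by
  have hD : 0 < G + K * η ^ 2 := by positivity
  have h2 : 0 < Real.sqrt 2 := by positivity
  have h22 : Real.sqrt 2 * Real.sqrt 2 = 2 := Real.mul_self_sqrt (by norm_num)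
  have hhalf : Real.sqrt (1 / 2) * Real.sqrt 2 = 1 := by
    rw [← Real.sqrt_mul (by norm_num)]; norm_num
  set ρ := fnorm (devM σ) with hρ
  set Δ := PsiDP η c σ / (G + K * η ^ 2) with hΔ
  have hΨ : Real.sqrt (1 / 2) * ρ + η / 3 * Matrix.trace σ - c = Δ * (G + K * η ^ 2) := by
    rw [hΔ, div_mul_cancel₀ _ hD.ne', PsiDP]
  have hΔ0 : 0 < Δ := div_pos hσ hD
  have hρ0 : 0 < ρ := by
    refine (fnorm_nonneg _).lt_of_ne' fun h => ?_
    rw [← hρ] at h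
    rw [h] at hs hΨ
    have := mul_pos hΔ0 hD
    linarith
  have hle : Δ * (G * Real.sqrt 2) ≤ ρ := by
    have hq : K * η ^ 2 / (G * Real.sqrt 2) * ρ * (G * Real.sqrt 2) = K * η ^ 2 * ρ := by
      field_simp
    have hm := mul_lt_mul_of_pos_right hs (mul_pos hG h2)
    rw [sub_mul, hq] at hm
    refine le_of_mul_le_mul_right ?_ hD
    linear_combination hm.le - (G * Real.sqrt 2) * hΨ + G * ρ * hhalf
  have hnn : 0 ≤ 1 - Δ * (G * Real.sqrt 2) * ρ⁻¹ := by
    rw [sub_nonneg, ← div_eq_mul_inv, div_le_one hρ0]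
    exact hle
  rw [smul_smul, PsiDP, devM_sub_smul_devM_sub_smul_one, trace_sub_smul_devM_sub_smul_one,
    fnorm_smul, abs_of_nonneg hnn, ← hρ]
  have hinv : ρ⁻¹ * ρ = 1 := inv_mul_cancel₀ hρ0.ne'
  linear_combination hΨ - Real.sqrt (1 / 2) * Δ * (G * Real.sqrt 2) * hinv - Δ * G * hhalf

/-- Global admissibility of the Drucker–Prager return mapping: for every strain `ε`
the returned stress is admissible, i.e. `Ψ(T_k(ε)) ≤ 0`. -/
theorem druckerPrager_admissible (K G η c : ℝ)
    (hK : 0 < K) (hG : 0 < G) (hη : 0 < η) (hc : 0 < c)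
    (εp : Matrix (Fin 3) (Fin 3) ℝ) (hεp : εp.IsSymm) :
    ∀ ε : Matrix (Fin 3) (Fin 3) ℝ, ε.IsSymm → PsiDP η c (TDP K G η c εp ε) ≤ 0 := by
  intro ε _
  simp only [TDP]
  split_ifs with hel hsm
  · exact hel
  · exact (PsiDP_smooth_return hK hG (not_le.mp hel) hsm).le
  · exact (PsiDP_apex hη.ne' c).le
end
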